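/- Let q ≥ 1 be an integer. The effective scaling map Υ restricts to a bijection from 𝒟^q onto 𝒟̄^q. -/

import Mathlib

open Set Filter

noncomputable section

/-- `f ∈ 𝒞`: continuous, non-decreasing, `ℝ₊`-valued on `ℝ₊`, with `f 0 = 0`. -/
def memC (f : ℝ → ℝ) : Prop :=
  ContinuousOn f (Ici 0) ∧ MonotoneOn f (Ici 0) ∧ f 0 = 0 ∧ ∀ u ∈ Ici (0:ℝ), 0 ≤ f u

/-- `f ∈ 𝒞^↑`: member of `𝒞` that is strictly increasing and tends to `∞` at `∞`. -/
def memCup (f : ℝ → ℝ) : Prop :=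
  memC f ∧ StrictMonoOn f (Ici 0) ∧ Tendsto f atTop atTop

/-- the soliton size associated with the index `i : Fin I`, namely `i+1`, as a real number. -/
def sz {I : ℕ} (i : Fin I) : ℝ := (i : ℕ) + 1

/-- the effective-distance (integrated slot density) function `φ_i`. -/
def phi {I : ℕ} (ψ : Fin I → ℝ → ℝ) (i : Fin I) (u : ℝ) : ℝ :=
  u - ∑ j, 2 * min (sz i) (sz j) * ψ j u

/-- the top effective-distance function `φ_I` (note `min (I, j) = j` for `j ≤ I`). -/
def phiTop {I : ℕ} (ψ : Fin I → ℝ → ℝ) (u : ℝ) : ℝ :=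
  u - ∑ j, 2 * sz j * ψ j u

/-- `ψ ∈ 𝓕`. -/
def memF {I : ℕ} (ψ : Fin I → ℝ → ℝ) : Prop :=
  (∀ i, memC (ψ i)) ∧ memCup (phiTop ψ)

/-- the inverse of `f : ℝ₊ → ℝ₊` (as a function `ℝ → ℝ` supported in domain `Ici 0`). -/
def rinv (f : ℝ → ℝ) : ℝ → ℝ := Function.invFunOn f (Ici 0)

/-- the effective scaling (scattering) map `Υ`. -/
def Upsilon {I : ℕ} (ψ : Fin I → ℝ → ℝ) : Fin I → ℝ → ℝ :=
  fun i => ψ i ∘ rinv (phi ψ i)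

/-- `gammaK ψb k = γ_{I-k}`, defined by downward recursion from `γ_I = id`:
`γ_i(z) = z + ∑_{j>i} 2(j-i) ψb_j (γ_j z)`. -/
def gammaK {I : ℕ} (ψb : Fin I → ℝ → ℝ) : ℕ → ℝ → ℝ
  | 0 => fun z => z
  | k + 1 => fun z =>
      z + ∑ m ∈ (Finset.range (k + 1)).attach,
        2 * (((k + 1 : ℕ) : ℝ) - ((m : ℕ) : ℝ)) *
          (if h : (m : ℕ) < I then
              ψb ⟨I - 1 - (m : ℕ), by omega⟩ (gammaK ψb (m : ℕ) z)
            else 0)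
  termination_by k => k
  decreasing_by have hm := Finset.mem_range.mp m.2; omega

/-- `γ_i`, for `i = 0, 1, …, I`. -/
def gam {I : ℕ} (ψb : Fin I → ℝ → ℝ) (i : ℕ) : ℝ → ℝ := gammaK ψb (I - i)

/-- the spatial reconstruction (inverse scattering) map `Γ`. -/
def Gamma {I : ℕ} (ψb : Fin I → ℝ → ℝ) : Fin I → ℝ → ℝ :=
  fun i => ψb i ∘ gam ψb ((i : ℕ) + 1) ∘ rinv (gam ψb 0)

/-- the free-evolution shift `θ_t`. -/
def theta {I : ℕ} (t : ℝ) (ψb : Fin I → ℝ → ℝ) : Fin I → ℝ → ℝ :=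
  fun i z => ψb i (max (z - sz i * t) 0)

/-- `ψ ∈ 𝒟`: member of `𝓕` satisfying the density condition
`∑_i i · sup_{u₁≠u₂} (ψ_i(u₁)-ψ_i(u₂))/(φ_i(u₁)-φ_i(u₂)) < 1/2`. -/
def memD {I : ℕ} (ψ : Fin I → ℝ → ℝ) : Prop :=
  memF ψ ∧
  ∃ c : Fin I → ℝ,
    (∀ i, ∀ u₁ ∈ Ici (0:ℝ), ∀ u₂ ∈ Ici (0:ℝ), u₂ < u₁ →
      ψ i u₁ - ψ i u₂ ≤ c i * (phi ψ i u₁ - phi ψ i u₂)) ∧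
    ∑ i, sz i * c i < 1 / 2

/-- `ψb ∈ 𝒟̄`: member of `𝒞^I` satisfying the density condition
`∑_i i · sup_{z₁≠z₂} (ψb_i(z₁)-ψb_i(z₂))/(z₁-z₂) < 1/2`. -/
def memDbar {I : ℕ} (ψb : Fin I → ℝ → ℝ) : Prop :=
  (∀ i, memC (ψb i)) ∧
  ∃ c : Fin I → ℝ,
    (∀ i, ∀ z₁ ∈ Ici (0:ℝ), ∀ z₂ ∈ Ici (0:ℝ), z₂ < z₁ →
      ψb i z₁ - ψb i z₂ ≤ c i * (z₁ - z₂)) ∧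
    ∑ i, sz i * c i < 1 / 2

/-- the extension `f^ℝ` of `f` to `ℝ`, by `0` on the negative half-line. -/
def extZ (f : ℝ → ℝ) : ℝ → ℝ := fun u => if 0 ≤ u then f u else 0

/-- the extension `f^{ℝ,↑}` of `f` to `ℝ`, by the identity on the negative half-line. -/
def extId (f : ℝ → ℝ) : ℝ → ℝ := fun u => if 0 ≤ u then f u else u

/-- `f ∈ 𝒞^q`. -/
def memCq (q : ℕ) (f : ℝ → ℝ) : Prop := memC f ∧ ContDiff ℝ q (extZ f)

/-- `f ∈ 𝒞^{↑,q}`. -/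
def memCupq (q : ℕ) (f : ℝ → ℝ) : Prop := memCup f ∧ ContDiff ℝ q (extId f)

/-- `f ∈ C^q(ℝ₊², ℝ₊)`: `ℝ₊`-valued and `q`-times continuously differentiable on the
quadrant (one-sided at the boundary). -/
def memCqTwo (q : ℕ) (f : ℝ → ℝ → ℝ) : Prop :=
  (∀ u ∈ Ici (0:ℝ), ∀ t ∈ Ici (0:ℝ), 0 ≤ f u t) ∧
  ContDiffOn ℝ q (fun p : ℝ × ℝ => f p.1 p.2) (Ici 0 ×ˢ Ici 0)

/-- the matrix `M(ρ)`. -/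
def Mmat {I : ℕ} (ρ : Fin I → ℝ) : Matrix (Fin I) (Fin I) ℝ :=
  Matrix.of fun i j =>
    if i = j then 1 - ∑ k ∈ Finset.univ.erase i, 2 * min (sz i) (sz k) * ρ k
    else 2 * min (sz i) (sz j) * ρ j

/-- the effective speeds `v^eff(ρ) = M(ρ)⁻¹ v`, where `v_i = i`. -/
def veff {I : ℕ} (ρ : Fin I → ℝ) : Fin I → ℝ :=
  ((Mmat ρ)⁻¹).mulVec fun i => sz i

/-- `ρ ∈ 𝒟_density`. -/
def memDdensity {I : ℕ} (ρ : Fin I → ℝ → ℝ) : Prop :=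
  (∀ i, (∀ u ∈ Ici (0:ℝ), 0 ≤ ρ i u) ∧ ContDiff ℝ 1 (extZ (ρ i))) ∧
  (∀ u ∈ Ici (0:ℝ), ∑ i, 2 * sz i * ρ i u < 1) ∧
  ∃ c : Fin I → ℝ,
    (∀ i, ∀ u ∈ Ici (0:ℝ),
      ρ i u ≤ c i * (1 - ∑ j, 2 * min (sz i) (sz j) * ρ j u)) ∧
    ∑ i, sz i * c i < 1 / 2

/-- `f` vanishes at `0`, is continuous on `ℝ₊`, and has all slopes at least `δ` there. -/
structure IsExpanding (δ : ℝ) (f : ℝ → ℝ) : Prop where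
  continuousOn : ContinuousOn f (Ici 0)
  map_zero : f 0 = 0
  le_sub : ∀ ⦃x y : ℝ⦄, 0 ≤ x → x ≤ y → δ * (y - x) ≤ f y - f x

namespace IsExpanding

variable {δ : ℝ} {f : ℝ → ℝ}

theorem strictMonoOn (hf : IsExpanding δ f) (hδ : 0 < δ) : StrictMonoOn f (Ici 0) := by
  intro x hx y _ hxy
  have h1 := hf.le_sub hx hxy.le
  have h2 := mul_pos hδ (sub_pos.2 hxy)
  linarith

theorem mapsTo (hf : IsExpanding δ f) (hδ : 0 < δ) : MapsTo f (Ici 0) (Ici 0) := by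
  intro x hx
  have h := (hf.strictMonoOn hδ).monotoneOn self_mem_Ici hx hx
  rwa [hf.map_zero] at h

theorem surjOn (hf : IsExpanding δ f) (hδ : 0 < δ) : SurjOn f (Ici 0) (Ici 0) := by
  intro y hy
  have hy : 0 ≤ y := hy
  have hyδ : 0 ≤ y / δ := by positivity
  have h := hf.le_sub le_rfl hyδ
  rw [hf.map_zero, sub_zero, sub_zero, mul_div_cancel₀ _ hδ.ne'] at h
  obtain ⟨x, hx, hxy⟩ := intermediate_value_Icc hyδ
    (hf.continuousOn.mono Icc_subset_Ici_self) (show y ∈ Icc (f 0) _ from ⟨hf.map_zero.trans_le hy, h⟩)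
  exact ⟨x, hx.1, hxy⟩

theorem rinv_mem (hf : IsExpanding δ f) (hδ : 0 < δ) {y : ℝ} (hy : 0 ≤ y) : 0 ≤ rinv f y :=
  Function.invFunOn_mem (hf.surjOn hδ hy)

theorem apply_rinv (hf : IsExpanding δ f) (hδ : 0 < δ) {y : ℝ} (hy : 0 ≤ y) :
    f (rinv f y) = y :=
  Function.invFunOn_eq (hf.surjOn hδ hy)

theorem rinv_apply (hf : IsExpanding δ f) (hδ : 0 < δ) {x : ℝ} (hx : 0 ≤ x) :
    rinv f (f x) = x := by
  have hfx : 0 ≤ f x := hf.mapsTo hδ hx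
  exact (hf.strictMonoOn hδ).injOn (hf.rinv_mem hδ hfx) hx (hf.apply_rinv hδ hfx)

theorem rinv_strictMonoOn (hf : IsExpanding δ f) (hδ : 0 < δ) :
    StrictMonoOn (rinv f) (Ici 0) := by
  intro x hx y hy hxy
  rw [← (hf.strictMonoOn hδ).lt_iff_lt (hf.rinv_mem hδ hx) (hf.rinv_mem hδ hy),
    hf.apply_rinv hδ hx, hf.apply_rinv hδ hy]
  exact hxy

theorem rinv_continuousOn (hf : IsExpanding δ f) (hδ : 0 < δ) :
    ContinuousOn (rinv f) (Ici 0) := by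
  have key : ∀ x y : ℝ, 0 ≤ x → 0 ≤ y → x ≤ y →
      |rinv f x - rinv f y| ≤ δ⁻¹ * |x - y| := by
    intro x y hx hy hxy
    have hle := (hf.rinv_strictMonoOn hδ).monotoneOn hx hy hxy
    have h := hf.le_sub (hf.rinv_mem hδ hx) hle
    rw [hf.apply_rinv hδ hx, hf.apply_rinv hδ hy] at h
    rw [abs_sub_comm, abs_sub_comm x, abs_of_nonneg (sub_nonneg.2 hle),
      abs_of_nonneg (sub_nonneg.2 hxy), inv_mul_eq_div, le_div_iff₀ hδ]
    linarith
  refine (LipschitzOnWith.of_dist_le_mul (K := Real.toNNReal δ⁻¹) ?_).continuousOn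
  intro x hx y hy
  rw [Real.coe_toNNReal _ (inv_nonneg.2 hδ.le), Real.dist_eq, Real.dist_eq]
  rcases le_total x y with h | h
  · exact key x y hx hy h
  · rw [abs_sub_comm, abs_sub_comm x]
    exact key y x hy hx h

theorem rinv_zero (hf : IsExpanding δ f) (hδ : 0 < δ) : rinv f 0 = 0 := by
  simpa [hf.map_zero] using hf.rinv_apply hδ le_rfl

theorem memC_of_pos (hf : IsExpanding δ f) (hδ : 0 < δ) : memC f :=
  ⟨hf.continuousOn, (hf.strictMonoOn hδ).monotoneOn, hf.map_zero, hf.mapsTo hδ⟩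

theorem memCup_rinv (hf : IsExpanding δ f) (hδ : 0 < δ) : memCup (rinv f) := by
  refine ⟨⟨hf.rinv_continuousOn hδ, (hf.rinv_strictMonoOn hδ).monotoneOn, hf.rinv_zero hδ,
    fun _ => hf.rinv_mem hδ⟩, hf.rinv_strictMonoOn hδ, tendsto_atTop.2 fun b => ?_⟩
  have hb : (0 : ℝ) ≤ max b 0 := le_max_right _ _
  have hfb : 0 ≤ f (max b 0) := hf.mapsTo hδ hb
  filter_upwards [eventually_ge_atTop (f (max b 0))] with u hu
  have h := (hf.rinv_strictMonoOn hδ).monotoneOn hfb (hfb.trans hu) hu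
  rw [hf.rinv_apply hδ hb] at h
  exact (le_max_left _ _).trans h

theorem extId_le_sub (hf : IsExpanding δ f) (hδ : 0 < δ) {x y : ℝ} (hxy : x ≤ y) :
    min δ 1 * (y - x) ≤ extId f y - extId f x := by
  have hε : 0 < min δ 1 := lt_min hδ one_pos
  have h1 : min δ 1 ≤ 1 := min_le_right _ _
  have h2 : min δ 1 ≤ δ := min_le_left _ _
  unfold extId
  split_ifs with hy hx hx
  · have := hf.le_sub hx hxy
    nlinarith
  · have := hf.le_sub le_rfl hy
    rw [hf.map_zero] at this
    nlinarith
  · linarith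
  · nlinarith

theorem contDiff_extId_rinv (hf : IsExpanding δ f) (hδ : 0 < δ) {q : ℕ} (hq : 1 ≤ q)
    (h : ContDiff ℝ q (extId f)) : ContDiff ℝ q (extId (rinv f)) := by
  have hε : 0 < min δ 1 := lt_min hδ one_pos
  have hmono : StrictMono (extId f) := by
    intro x y hxy
    have h1 := hf.extId_le_sub hδ hxy.le
    have h2 := mul_pos hε (sub_pos.2 hxy)
    linarith
  have hinv : Function.RightInverse (extId (rinv f)) (extId f) := by
    intro y
    by_cases hy : 0 ≤ y
    · simp [extId, hy, hf.rinv_mem hδ hy, hf.apply_rinv hδ hy]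
    · simp [extId, hy]
  have hdiff : Differentiable ℝ (extId f) :=
    h.differentiable (by exact_mod_cast (Nat.one_le_iff_ne_zero.1 hq))
  refine (hmono.orderIsoOfRightInverse _ _ hinv).toHomeomorph.contDiff_symm_deriv
    (f' := deriv (extId f)) (fun x => ?_) (fun x => (hdiff x).hasDerivAt) h
  have hslope : ∀ y, y ≠ x → min δ 1 ≤ slope (extId f) x y := by
    intro y hy
    rw [slope_def_field]
    rcases lt_or_gt_of_ne hy with hlt | hlt
    · rw [le_div_iff_of_neg (sub_neg.2 hlt)]
      have := hf.extId_le_sub hδ hlt.le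
      linarith
    · rw [le_div_iff₀ (sub_pos.2 hlt)]
      exact hf.extId_le_sub hδ hlt.le
  have hderiv : min δ 1 ≤ deriv (extId f) x :=
    ge_of_tendsto (hasDerivAt_iff_tendsto_slope.1 (hdiff x).hasDerivAt)
      (eventually_nhdsWithin_of_forall hslope)
  exact (hε.trans_le hderiv).ne'

end IsExpanding

theorem memC.comp {f g : ℝ → ℝ} (hg : memC g) (hf : memC f) : memC (g ∘ f) :=
  ⟨hg.1.comp hf.1 hf.2.2.2, hg.2.1.comp hf.2.1 hf.2.2.2, by simp [hf.2.2.1, hg.2.2.1],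
    fun u hu => hg.2.2.2 _ (hf.2.2.2 u hu)⟩

theorem memC.congr {f g : ℝ → ℝ} (hf : memC f) (h : EqOn g f (Ici 0)) : memC g :=
  ⟨hf.1.congr h, hf.2.1.congr h.symm, (h self_mem_Ici).trans hf.2.2.1,
    fun u hu => (h hu).symm ▸ hf.2.2.2 u hu⟩

theorem memCup.congr {f g : ℝ → ℝ} (hf : memCup f) (h : EqOn g f (Ici 0)) : memCup g :=
  ⟨hf.1.congr h, hf.2.1.congr h.symm,
    hf.2.2.congr' ((eventually_ge_atTop 0).mono fun _ hu => (h hu).symm)⟩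

theorem extZ_comp {f : ℝ → ℝ} (g : ℝ → ℝ) (hf : memC f) :
    extZ (g ∘ f) = extZ g ∘ extId f := by
  funext u
  by_cases hu : 0 ≤ u
  · simp [extZ, extId, hu, hf.2.2.2 u hu]
  · simp [extZ, extId, hu]

theorem sz_pos {I : ℕ} (i : Fin I) : 0 < sz i := by
  unfold sz; positivity

section Scattering

variable {I : ℕ}

theorem phi_eq_phiTop_add (ψ : Fin I → ℝ → ℝ) (i : Fin I) (u : ℝ) :
    phi ψ i u = phiTop ψ u + ∑ j, 2 * (sz j - min (sz i) (sz j)) * ψ j u := by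
  simp only [phi, phiTop, sub_add, ← Finset.sum_sub_distrib]
  congr 1
  exact Finset.sum_congr rfl fun j _ => by ring

theorem phi_sub_le {ψ : Fin I → ℝ → ℝ} (hψ : ∀ i, memC (ψ i)) (i : Fin I) {x y : ℝ}
    (hx : 0 ≤ x) (hxy : x ≤ y) : phi ψ i y - phi ψ i x ≤ y - x := by
  have : ∑ j, 2 * min (sz i) (sz j) * ψ j x ≤ ∑ j, 2 * min (sz i) (sz j) * ψ j y := by
    refine Finset.sum_le_sum fun j _ => mul_le_mul_of_nonneg_left
      ((hψ j).2.1 hx (hx.trans hxy) hxy) ?_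
    have := lt_min (sz_pos i) (sz_pos j)
    positivity
  unfold phi
  linarith

theorem phiTop_sub_le_phi_sub {ψ : Fin I → ℝ → ℝ} (hψ : ∀ i, memC (ψ i)) (i : Fin I) {x y : ℝ}
    (hx : 0 ≤ x) (hxy : x ≤ y) : phiTop ψ y - phiTop ψ x ≤ phi ψ i y - phi ψ i x := by
  have : ∑ j, 2 * (sz j - min (sz i) (sz j)) * ψ j x ≤
      ∑ j, 2 * (sz j - min (sz i) (sz j)) * ψ j y := by
    refine Finset.sum_le_sum fun j _ => mul_le_mul_of_nonneg_left
      ((hψ j).2.1 hx (hx.trans hxy) hxy) ?_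
    have := min_le_right (sz i) (sz j)
    linarith
  rw [phi_eq_phiTop_add, phi_eq_phiTop_add]
  linarith

theorem phiTop_zero {ψ : Fin I → ℝ → ℝ} (hψ : ∀ i, memC (ψ i)) : phiTop ψ 0 = 0 := by
  simp [phiTop, (hψ _).2.2.1]

theorem phi_zero {ψ : Fin I → ℝ → ℝ} (hψ : ∀ i, memC (ψ i)) (i : Fin I) : phi ψ i 0 = 0 := by
  simp [phi, (hψ _).2.2.1]

theorem phiTop_sub_ge {ψ : Fin I → ℝ → ℝ} (hψ : memF ψ) {c : Fin I → ℝ}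
    (hc : ∀ i, ∀ u₁ ∈ Ici (0:ℝ), ∀ u₂ ∈ Ici (0:ℝ), u₂ < u₁ →
      ψ i u₁ - ψ i u₂ ≤ c i * (phi ψ i u₁ - phi ψ i u₂)) {x y : ℝ} (hx : 0 ≤ x) (hxy : x ≤ y) :
    (1 - 2 * ∑ i, sz i * c i) * (y - x) ≤ phiTop ψ y - phiTop ψ x := by
  obtain ⟨hψ, htop⟩ := hψ
  rcases hxy.eq_or_lt with rfl | hlt
  · simp
  have hbound : ∀ j, ψ j y - ψ j x ≤ c j * (y - x) := by
    intro j
    have h1 := hc j y (hx.trans hxy) x hx hlt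
    have h2 := phi_sub_le hψ j hx hxy
    have h3 := phiTop_sub_le_phi_sub hψ j hx hxy
    have h4 := htop.2.1 hx (hx.trans hxy) hlt
    have h5 := (hψ j).2.1 hx (hx.trans hxy) hxy
    have hcj : 0 ≤ c j := by
      by_contra hneg
      have := mul_neg_of_neg_of_pos (not_le.1 hneg)
        (show 0 < phi ψ j y - phi ψ j x by linarith)
      linarith
    exact h1.trans (mul_le_mul_of_nonneg_left h2 hcj)
  have hsum : ∑ j, 2 * sz j * ψ j y - ∑ j, 2 * sz j * ψ j x ≤
      2 * (∑ j, sz j * c j) * (y - x) := by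
    rw [← Finset.sum_sub_distrib, Finset.mul_sum, Finset.sum_mul]
    refine Finset.sum_le_sum fun j _ => ?_
    have := mul_le_mul_of_nonneg_left (hbound j) (sz_pos j).le
    linarith
  unfold phiTop
  linarith

theorem continuousOn_sub_sum {ψ : Fin I → ℝ → ℝ} (hψ : ∀ i, memC (ψ i)) (a : Fin I → ℝ) :
    ContinuousOn (fun u => u - ∑ j, a j * ψ j u) (Ici 0) :=
  continuousOn_id.sub (continuousOn_finsetSum _ fun j _ => continuousOn_const.mul (hψ j).1)

theorem memD.exists_isExpanding {ψ : Fin I → ℝ → ℝ} (h : memD ψ) :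
    ∃ δ : ℝ, 0 < δ ∧ IsExpanding δ (phiTop ψ) ∧ ∀ i, IsExpanding δ (phi ψ i) := by
  obtain ⟨hF, c, hc, hlt⟩ := h
  refine ⟨1 - 2 * ∑ i, sz i * c i, by linarith, ⟨continuousOn_sub_sum hF.1 _, phiTop_zero hF.1,
    fun x y hx hxy => phiTop_sub_ge hF hc hx hxy⟩, fun i => ⟨continuousOn_sub_sum hF.1 _,
    phi_zero hF.1 i, fun x y hx hxy => (phiTop_sub_ge hF hc hx hxy).trans
      (phiTop_sub_le_phi_sub hF.1 i hx hxy)⟩⟩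

theorem contDiff_extId_phi {ψ : Fin I → ℝ → ℝ} {q : ℕ} (hψ : ∀ i, ContDiff ℝ q (extZ (ψ i)))
    (i : Fin I) : ContDiff ℝ q (extId (phi ψ i)) := by
  have : extId (phi ψ i) = fun u => u - ∑ j, 2 * min (sz i) (sz j) * extZ (ψ j) u := by
    funext u
    by_cases hu : 0 ≤ u <;> simp [extId, extZ, phi, hu]
  rw [this]
  exact contDiff_id.sub (ContDiff.sum fun j _ => contDiff_const.mul (hψ j))

theorem gam_eq (ψb : Fin I → ℝ → ℝ) {i : ℕ} (hi : i ≤ I) (z : ℝ) :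
    gam ψb i z = z + ∑ j, 2 * (sz j - min (i : ℝ) (sz j)) * ψb j (gam ψb ((j : ℕ) + 1) z) := by
  rcases hi.eq_or_lt with rfl | hlt
  · have : ∑ j : Fin i, 2 * (sz j - min (i : ℝ) (sz j)) * ψb j (gam ψb ((j : ℕ) + 1) z) = 0 := by
      refine Finset.sum_eq_zero fun j _ => ?_
      have hj : sz j ≤ (i : ℝ) := by
        unfold sz; exact_mod_cast j.2
      simp [min_eq_right hj]
    rw [this, add_zero, gam, Nat.sub_self, gammaK]
  obtain ⟨k, hk⟩ : ∃ k, I - i = k + 1 := ⟨I - i - 1, by omega⟩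
  rw [gam, hk, gammaK, Finset.sum_fin_eq_sum_range, ← Finset.sum_range_reflect]
  beta_reduce
  rw [Finset.sum_attach (Finset.range (k + 1)) (fun m => 2 * (((k + 1 : ℕ) : ℝ) - (m : ℝ)) *
          (if h : m < I then
              ψb ⟨I - 1 - m, by omega⟩ (gammaK ψb m z)
            else 0))]
  congr 1
  have hsub : Finset.range (k + 1) ⊆ Finset.range I := Finset.range_subset_range.2 (by omega)
  have hiI : (i : ℝ) = I - (k + 1) := by
    rw [eq_sub_iff_add_eq]; exact_mod_cast (by omega : i + (k + 1) = I)
  rw [← Finset.sum_subset hsub]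
  · refine Finset.sum_congr rfl fun m hm => ?_
    have hm := Finset.mem_range.1 hm
    have hmI : m < I := by omega
    have hmI' : I - 1 - m < I := by omega
    have hcast : ((I - 1 - m : ℕ) : ℝ) = I - 1 - m := by
      rw [Nat.sub_sub, Nat.cast_sub (by omega)]; push_cast; ring
    have hmk : (m : ℝ) ≤ k := by exact_mod_cast (by omega : m ≤ k)
    rw [dif_pos hmI, dif_pos hmI', gam, show I - (I - 1 - m + 1) = m by omega]
    simp only [sz, hcast]
    rw [min_eq_left (by linarith), hiI]
    push_cast
    ring
  · intro m hm hmk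
    have hm := Finset.mem_range.1 hm
    have hmk : k + 1 ≤ m := by simpa using hmk
    have hmI' : I - 1 - m < I := by omega
    have hcast : ((I - 1 - m : ℕ) : ℝ) = I - 1 - m := by
      rw [Nat.sub_sub, Nat.cast_sub (by omega)]; push_cast; ring
    have hmk' : (k : ℝ) + 1 ≤ m := by exact_mod_cast hmk
    rw [dif_pos hmI']
    simp only [sz, hcast]
    rw [min_eq_right (by linarith)]
    ring

theorem downward_induction {P : ℕ → Prop}
    (h : ∀ i ≤ I, (∀ j, i < j → j ≤ I → P j) → P i) : ∀ i ≤ I, P i := by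
  have key : ∀ k i, i ≤ I → I - i = k → P i := by
    intro k
    induction k using Nat.strong_induction_on with
    | _ k ih =>
      intro i hi hik
      exact h i hi fun j hij hj => ih (I - j) (by omega) j hj rfl
  exact fun i hi => key _ i hi rfl

theorem sz_sub_min_nonneg (i : ℕ) (j : Fin I) : 0 ≤ 2 * (sz j - min (i : ℝ) (sz j)) := by
  have := min_le_right (i : ℝ) (sz j)
  linarith

theorem sz_sub_min_eq_zero {i : ℕ} {j : Fin I} (h : ¬ i < (j : ℕ) + 1) :
    2 * (sz j - min (i : ℝ) (sz j)) = 0 := by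
  have hj : sz j ≤ (i : ℝ) := by
    unfold sz; exact_mod_cast not_lt.1 h
  simp [min_eq_right hj]

theorem isExpanding_gam {ψb : Fin I → ℝ → ℝ} (hψ : ∀ i, memC (ψb i)) :
    ∀ i ≤ I, IsExpanding 1 (gam ψb i) := by
  refine downward_induction fun i hi ih => ?_
  have hterm : ∀ j : Fin I, i < (j : ℕ) + 1 → memC (ψb j ∘ gam ψb ((j : ℕ) + 1)) :=
    fun j hj => (hψ j).comp ((ih _ hj j.2).memC_of_pos one_pos)
  refine ⟨?_, ?_, fun x y hx hxy => ?_⟩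
  · refine ContinuousOn.congr (continuousOn_id.add (continuousOn_finsetSum Finset.univ
      fun j _ => ?_)) fun z _ => gam_eq ψb hi z
    by_cases hj : i < (j : ℕ) + 1
    · exact continuousOn_const.mul (hterm j hj).1
    · simp only [sz_sub_min_eq_zero hj, zero_mul]
      exact continuousOn_const
  · rw [gam_eq ψb hi, zero_add]
    refine Finset.sum_eq_zero fun j _ => ?_
    by_cases hj : i < (j : ℕ) + 1
    · exact mul_eq_zero_of_right _ (hterm j hj).2.2.1
    · rw [sz_sub_min_eq_zero hj, zero_mul]
  · have : ∑ j, 2 * (sz j - min (i : ℝ) (sz j)) * ψb j (gam ψb ((j : ℕ) + 1) x) ≤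
        ∑ j, 2 * (sz j - min (i : ℝ) (sz j)) * ψb j (gam ψb ((j : ℕ) + 1) y) := by
      refine Finset.sum_le_sum fun j _ => ?_
      by_cases hj : i < (j : ℕ) + 1
      · exact mul_le_mul_of_nonneg_left ((hterm j hj).2.1 hx (hx.trans hxy) hxy)
          (sz_sub_min_nonneg i j)
      · simp [sz_sub_min_eq_zero hj]
    rw [gam_eq ψb hi, gam_eq ψb hi]
    linarith

theorem contDiff_extId_gam {ψb : Fin I → ℝ → ℝ} (hψ : ∀ i, memC (ψb i)) {q : ℕ}
    (hq : ∀ i, ContDiff ℝ q (extZ (ψb i))) : ∀ i ≤ I, ContDiff ℝ q (extId (gam ψb i)) := by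
  refine downward_induction fun i hi ih => ?_
  have : extId (gam ψb i) = fun z => z + ∑ j, 2 * (sz j - min (i : ℝ) (sz j)) *
      (extZ (ψb j) ∘ extId (gam ψb ((j : ℕ) + 1))) z := by
    funext z
    simp only [← extZ_comp (ψb _) ((isExpanding_gam hψ _ (Fin.is_lt _)).memC_of_pos one_pos)]
    by_cases hz : 0 ≤ z
    · simp only [extId, extZ, hz, if_true, Function.comp_apply]
      exact gam_eq ψb hi z
    · simp [extId, extZ, hz]
  rw [this]
  refine contDiff_id.add (ContDiff.sum fun j _ => ?_)
  by_cases hj : i < (j : ℕ) + 1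
  · exact contDiff_const.mul ((hq j).comp (ih _ hj j.2))
  · simp only [sz_sub_min_eq_zero hj, zero_mul]
    exact contDiff_const

theorem cast_succ_eq_sz (i : Fin I) : (((i : ℕ) + 1 : ℕ) : ℝ) = sz i := by
  simp [sz]

theorem gam_Upsilon_phiTop {ψ : Fin I → ℝ → ℝ}
    {δ : ℝ} (hδ : 0 < δ) (hphi : ∀ i, IsExpanding δ (phi ψ i)) {u : ℝ} (hu : 0 ≤ u) :
    ∀ i ≤ I, gam (Upsilon ψ) i (phiTop ψ u) =
      phiTop ψ u + ∑ j, 2 * (sz j - min (i : ℝ) (sz j)) * ψ j u := by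
  refine downward_induction fun i hi ih => ?_
  rw [gam_eq _ hi]
  congr 1
  refine Finset.sum_congr rfl fun j _ => ?_
  by_cases hj : i < (j : ℕ) + 1
  · rw [ih _ hj j.2, cast_succ_eq_sz, ← phi_eq_phiTop_add, Upsilon, Function.comp_apply,
      (hphi j).rinv_apply hδ hu]
  · simp [sz_sub_min_eq_zero hj]

theorem Gamma_Upsilon {ψ : Fin I → ℝ → ℝ} (hΥ : ∀ i, memC (Upsilon ψ i))
    {δ : ℝ} (hδ : 0 < δ) (htop : IsExpanding δ (phiTop ψ))
    (hphi : ∀ i, IsExpanding δ (phi ψ i)) (i : Fin I) :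
    EqOn (Gamma (Upsilon ψ) i) (ψ i) (Ici 0) := by
  intro u hu
  have hgam : ∀ j : ℕ, j ≤ I → _ := gam_Upsilon_phiTop hδ hphi hu
  have h0 : gam (Upsilon ψ) 0 (phiTop ψ u) = u := by
    rw [hgam 0 (Nat.zero_le _)]
    simp [phiTop, min_eq_left (sz_pos _).le]
  have hinv : rinv (gam (Upsilon ψ) 0) u = phiTop ψ u := by
    have := (isExpanding_gam hΥ 0 (Nat.zero_le _)).rinv_apply one_pos (htop.mapsTo hδ hu)
    rwa [h0] at this
  simp only [Gamma, Function.comp_apply]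
  rw [hinv, hgam _ i.2, cast_succ_eq_sz, ← phi_eq_phiTop_add, Upsilon, Function.comp_apply,
    (hphi i).rinv_apply hδ hu]

theorem phiTop_Gamma {ψb : Fin I → ℝ → ℝ} (hψ : ∀ i, memC (ψb i)) :
    EqOn (phiTop (Gamma ψb)) (rinv (gam ψb 0)) (Ici 0) := by
  intro u hu
  have h := (isExpanding_gam hψ 0 (Nat.zero_le _)).apply_rinv one_pos hu
  rw [gam_eq ψb (Nat.zero_le _)] at h
  simp only [Nat.cast_zero, min_eq_left (sz_pos _).le, sub_zero] at h
  simp only [phiTop, Gamma, Function.comp_apply]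
  linarith

theorem phi_Gamma {ψb : Fin I → ℝ → ℝ} (hψ : ∀ i, memC (ψb i)) (i : Fin I) :
    EqOn (phi (Gamma ψb) i) (gam ψb ((i : ℕ) + 1) ∘ rinv (gam ψb 0)) (Ici 0) := by
  intro u hu
  rw [phi_eq_phiTop_add, phiTop_Gamma hψ hu, Function.comp_apply, gam_eq ψb i.2, cast_succ_eq_sz]
  rfl

theorem Upsilon_restrict {ψ : Fin I → ℝ → ℝ} (h : memD ψ) {q : ℕ} (hq : 1 ≤ q)
    (hψ : ∀ i, memCq q (ψ i)) : memDbar (Upsilon ψ) ∧ ∀ i, memCq q (Upsilon ψ i) := by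
  obtain ⟨δ, hδ, -, hphi⟩ := h.exists_isExpanding
  have hC : ∀ i, memC (Upsilon ψ i) :=
    fun i => (hψ i).1.comp ((hphi i).memCup_rinv hδ).1
  refine ⟨⟨hC, ?_⟩, fun i => ⟨hC i, ?_⟩⟩
  · obtain ⟨-, c, hc, hlt⟩ := h
    refine ⟨c, fun i z₁ h₁ z₂ h₂ hz => ?_, hlt⟩
    have := hc i _ ((hphi i).rinv_mem hδ h₁) _ ((hphi i).rinv_mem hδ h₂)
      ((hphi i).rinv_strictMonoOn hδ h₂ h₁ hz)
    rwa [(hphi i).apply_rinv hδ h₁, (hphi i).apply_rinv hδ h₂] at this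
  · rw [Upsilon, extZ_comp _ ((hphi i).memCup_rinv hδ).1]
    exact (hψ i).2.comp ((hphi i).contDiff_extId_rinv hδ hq
      (contDiff_extId_phi (fun j => (hψ j).2) i))

theorem Gamma_restrict {ψb : Fin I → ℝ → ℝ} (h : memDbar ψb) {q : ℕ} (hq : 1 ≤ q)
    (hψ : ∀ i, memCq q (ψb i)) : memD (Gamma ψb) ∧ ∀ i, memCq q (Gamma ψb i) := by
  have hψC : ∀ i, memC (ψb i) := fun i => (hψ i).1
  have hgam := isExpanding_gam hψC
  have h0 := hgam 0 (Nat.zero_le _)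
  have hη := h0.memCup_rinv one_pos
  have hC : ∀ i, memC (Gamma ψb i) :=
    fun i => (hψC i).comp (((hgam _ i.2).memC_of_pos one_pos).comp hη.1)
  refine ⟨⟨⟨hC, hη.congr (phiTop_Gamma hψC)⟩, ?_⟩, fun i => ⟨hC i, ?_⟩⟩
  · obtain ⟨-, c, hc, hlt⟩ := h
    refine ⟨c, fun i u₁ h₁ u₂ h₂ hu => ?_, hlt⟩
    rw [phi_Gamma hψC i h₁, phi_Gamma hψC i h₂]
    exact hc i _ ((hgam _ i.2).mapsTo one_pos (h0.rinv_mem one_pos h₁)) _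
      ((hgam _ i.2).mapsTo one_pos (h0.rinv_mem one_pos h₂))
      ((hgam _ i.2).strictMonoOn one_pos (h0.rinv_mem one_pos h₂) (h0.rinv_mem one_pos h₁)
        (hη.2.1 h₂ h₁ hu))
  · have hsmooth := contDiff_extId_gam hψC (fun j => (hψ j).2)
    rw [Gamma, ← Function.comp_assoc, extZ_comp _ hη.1,
      extZ_comp _ ((hgam _ i.2).memC_of_pos one_pos)]
    exact ((hψ i).2.comp (hsmooth _ i.2)).comp
      (h0.contDiff_extId_rinv one_pos hq (hsmooth 0 (Nat.zero_le _)))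

theorem Upsilon_Gamma {ψb : Fin I → ℝ → ℝ} (hψ : ∀ i, memC (ψb i)) (hD : memD (Gamma ψb))
    (i : Fin I) : EqOn (Upsilon (Gamma ψb) i) (ψb i) (Ici 0) := by
  intro z hz
  obtain ⟨δ, hδ, -, hphi⟩ := hD.exists_isExpanding
  have h := phi_Gamma hψ i ((hphi i).rinv_mem hδ hz)
  rw [(hphi i).apply_rinv hδ hz] at h
  exact congrArg (ψb i) h.symm

end Scattering

/-- `Υ` restricts to a bijection from `𝒟^q` onto `𝒟̄^q` (with inverse `Γ`). -/
theorem stmt_13 {I : ℕ} (hI : 1 ≤ I) (q : ℕ) (hq : 1 ≤ q) :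
    (∀ ψ : Fin I → ℝ → ℝ, memD ψ → (∀ i, memCq q (ψ i)) →
      (memDbar (Upsilon ψ) ∧ ∀ i, memCq q (Upsilon ψ i)) ∧
      ∀ i, EqOn (Gamma (Upsilon ψ) i) (ψ i) (Ici 0)) ∧
    (∀ ψb : Fin I → ℝ → ℝ, memDbar ψb → (∀ i, memCq q (ψb i)) →
      (memD (Gamma ψb) ∧ ∀ i, memCq q (Gamma ψb i)) ∧
      ∀ i, EqOn (Upsilon (Gamma ψb) i) (ψb i) (Ici 0)) := by
  refine ⟨fun ψ hD hψ => ?_, fun ψb hD hψ => ?_⟩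
  · obtain ⟨δ, hδ, htop, hphi⟩ := hD.exists_isExpanding
    have h := Upsilon_restrict hD hq hψ
    exact ⟨h, Gamma_Upsilon h.1.1 hδ htop hphi⟩
  · have h := Gamma_restrict hD hq hψ
    exact ⟨h, Upsilon_Gamma hD.1 h.1⟩
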